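/- arXiv:2501.00394 — 4 statements merged into one kernel-verified Lean document; each statement's English description precedes it below -/
import Mathlib

section
/- Let R be a commutative ring, n ≥ 1, Q_1,…,Q_n ∈ R and c(k,l) ∈ R for 0 ≤ l ≤ k ≤ n+1 with c(k,k) = 1, satisfying hypotheses (E) and (R) below. Then for all integers 1 ≤ k < m ≤ n+1 one has c(k,k−1)·c(m,k) = c(m,k−1) + Q_k·c(m,k+1). (In the paper: c_t^S(S_k/S_{k−1}) * c_t^S(S_m/S_k) = c_t^S(S_m/S_{k−1}) + (−1)^{N_k+N_{k−1}} q_k · c_t^S(S_m/S_{k+1}) in QH*_S(Fl)[t].) -/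
/-- Axiomatized exchange relation: for `1 ≤ k < m ≤ n+1`,
`c(k,k−1)·c(m,k) = c(m,k−1) + Q_k·c(m,k+1)`
(in the paper `c_t^S(S_k/S_{k−1}) * c_t^S(S_m/S_k)
 = c_t^S(S_m/S_{k−1}) + (−1)^{N_k+N_{k−1}} q_k · c_t^S(S_m/S_{k+1})`). -/
theorem quantum_cluster_exchange_consecutive {R : Type*} [CommRing R] (n : ℕ) (hn : 1 ≤ n)
    (Q : ℕ → R) (c : ℕ → ℕ → R)
    (hdiag : ∀ k, k ≤ n + 1 → c k k = 1)
    (hE : ∀ k m : ℕ, 1 ≤ k → k < m → m ≤ n + 1 →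
      c k 0 * c m k = c m 0 + Q k * c m (k + 1) * c (k - 1) 0)
    (hR : ∀ l, l ≤ n + 1 → c l 0 ∈ nonZeroDivisors R) :
    ∀ k m : ℕ, 1 ≤ k → k < m → m ≤ n + 1 →
      c k (k - 1) * c m k = c m (k - 1) + Q k * c m (k + 1) := by
  intro k m hk hkm hm
  obtain ⟨j, rfl⟩ : ∃ j, k = j + 1 := ⟨k - 1, by omega⟩
  have hkm' := hE (j + 1) m hk hkm hm
  rw [Nat.add_sub_cancel] at hkm' ⊢
  rcases Nat.eq_zero_or_pos j with rfl | hj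
  · simpa [hdiag 0 (Nat.zero_le _)] using hkm'
  · have hjm := hE j m hj (by omega) hm
    have hjk := hE j (j + 1) hj (by omega) (by omega)
    rw [hdiag (j + 1) (by omega)] at hjk
    refine (mul_cancel_left_mem_nonZeroDivisors (hR j (by omega))).1 ?_
    linear_combination c m (j + 1) * hjk - hjm + hkm'
end

section
/- Let R be a commutative ring, n ≥ 1, Q_1,…,Q_n ∈ R and c(k,l) ∈ R for 0 ≤ l ≤ k ≤ n+1 with c(k,k) = 1, satisfying hypotheses (E) and (R) below. Then for all integers 0 ≤ l < k ≤ n one has c(k,l)·c(k+1,k) = c(k+1,l) + Q_k·c(k−1,l). (In the paper: c_t^S(S_k/S_l) * c_t^S(S_{k+1}/S_k) = c_t^S(S_{k+1}/S_l) + (−1)^{N_{k−1}+N_k} q_k · c_t^S(S_{k−1}/S_l) in QH*_S(Fl)[t], where the index l is allowed to be zero.) -/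
/-- Axiomatized exchange relation: for `0 ≤ l < k ≤ n`,
`c(k,l)·c(k+1,k) = c(k+1,l) + Q_k·c(k−1,l)`
(in the paper `c_t^S(S_k/S_l) * c_t^S(S_{k+1}/S_k)
 = c_t^S(S_{k+1}/S_l) + (−1)^{N_{k−1}+N_k} q_k · c_t^S(S_{k−1}/S_l)`,
 the index `l` being allowed to be zero). -/
theorem quantum_cluster_exchange_source {R : Type*} [CommRing R] (n : ℕ) (hn : 1 ≤ n)
    (Q : ℕ → R) (c : ℕ → ℕ → R)
    (hdiag : ∀ k, k ≤ n + 1 → c k k = 1)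
    (hE : ∀ k m : ℕ, 1 ≤ k → k < m → m ≤ n + 1 →
      c k 0 * c m k = c m 0 + Q k * c m (k + 1) * c (k - 1) 0)
    (hR : ∀ l, l ≤ n + 1 → c l 0 ∈ nonZeroDivisors R) :
    ∀ l k : ℕ, l < k → k ≤ n →
      c k l * c (k + 1) k = c (k + 1) l + Q k * c (k - 1) l := by
  have base : ∀ k, 1 ≤ k → k ≤ n →
      c k 0 * c (k + 1) k = c (k + 1) 0 + Q k * c (k - 1) 0 := by
    intro k hk hkn
    have h := hE k (k + 1) hk (by omega) (by omega)
    rwa [hdiag (k + 1) (by omega), mul_one] at h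
  have key : ∀ d l : ℕ, l + d + 1 ≤ n →
      c (l + d + 1) l * c (l + d + 2) (l + d + 1) =
        c (l + d + 2) l + Q (l + d + 1) * c (l + d) l := by
    intro d
    induction d with
    | zero =>
      intro l hl
      have h0 := base (l + 1) (by omega) hl
      rcases Nat.eq_zero_or_pos l with rfl | hpos
      · exact h0
      have h1 := hE l (l + 1) hpos (by omega) (by omega)
      have h2 := hE l (l + 2) hpos (by omega) (by omega)
      rw [hdiag (l + 1) (by omega)] at h1
      simp only [add_zero, Nat.add_sub_cancel] at h0 ⊢
      rw [hdiag l (by omega)]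
      refine (mul_cancel_left_mem_nonZeroDivisors (hR l (by omega))).mp ?_
      linear_combination h0 + c (l + 2) (l + 1) * h1 - h2
    | succ d ih =>
      intro l hl
      have h0 := base (l + d + 2) (by omega) hl
      rcases Nat.eq_zero_or_pos l with rfl | hpos
      · simpa [add_assoc] using h0
      have h1 := hE l (l + d + 1) hpos (by omega) (by omega)
      have h2 := hE l (l + d + 2) hpos (by omega) (by omega)
      have h3 := hE l (l + d + 3) hpos (by omega) (by omega)
      have h4 := ih (l + 1) (by omega)
      rw [show l + 1 + d = l + d + 1 by omega] at h4
      refine (mul_cancel_left_mem_nonZeroDivisors (hR l (by omega))).mp ?_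
      change c (l + d + 2) 0 * c (l + d + 3) (l + d + 2) =
        c (l + d + 3) 0 + Q (l + d + 2) * c (l + d + 1) 0 at h0
      change c l 0 * (c (l + d + 2) l * c (l + d + 3) (l + d + 2)) =
        c l 0 * (c (l + d + 3) l + Q (l + d + 2) * c (l + d + 1) l)
      linear_combination h0 + c (l + d + 3) (l + d + 2) * h2 - h3
        - Q (l + d + 2) * h1 + Q l * c (l - 1) 0 * h4
  intro l k hlk hk
  obtain ⟨d, rfl⟩ := Nat.exists_eq_add_of_lt hlk
  exact key d l hk
end

section
/- Let R be a commutative ring, n ≥ 1, Q_1,…,Q_n ∈ R and c(k,l) ∈ R for 0 ≤ l ≤ k ≤ n+1 with c(k,k) = 1, satisfying hypotheses (E) and (R) below. Then for all integers 0 ≤ l < k < m ≤ n+1 one has c(k,l)·c(m,k) = c(m,l) + Q_k·c(m,k+1)·c(k−1,l). (In the paper: c_t^S(S_k/S_l) * c_t^S(S_m/S_k) = c_t^S(S_m/S_l) + (−1)^{N_k+N_{k−1}} q_k · c_t^S(S_m/S_{k+1}) * c_t^S(S_{k−1}/S_l) in QH*_S(Fl)[t], where the index l is allowed to be zero.) 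-/
/-- Continuant recursion in the lower index: the exchange relation with `l + 1 = k`. -/
theorem exchange_of_succ {R : Type*} [CommRing R] {n : ℕ} {Q : ℕ → R} {c : ℕ → ℕ → R}
    (hdiag : ∀ k, k ≤ n + 1 → c k k = 1)
    (hE : ∀ k m : ℕ, 1 ≤ k → k < m → m ≤ n + 1 →
      c k 0 * c m k = c m 0 + Q k * c m (k + 1) * c (k - 1) 0)
    (hR : ∀ l, l ≤ n + 1 → c l 0 ∈ nonZeroDivisors R)
    {l m : ℕ} (hlm : l + 1 < m) (hm : m ≤ n + 1) :
    c (l + 1) l * c m (l + 1) = c m l + Q (l + 1) * c m (l + 2) := by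
  have hnext := hE (l + 1) m (by omega) hlm hm
  rw [Nat.add_sub_cancel] at hnext
  rcases Nat.eq_zero_or_pos l with rfl | hl
  · simpa [hdiag 0 (by omega)] using hnext
  · have hl_succ := hE l (l + 1) hl (by omega) (by omega)
    rw [hdiag (l + 1) (by omega)] at hl_succ
    have hl_m := hE l m hl (by omega) hm
    refine (mul_cancel_left_mem_nonZeroDivisors (hR l (by omega))).mp ?_
    linear_combination c m (l + 1) * hl_succ - hl_m + hnext

/-- The exchange relation follows from its instances with `l + 1 = k`. -/
theorem exchange_of_continuant {R : Type*} [CommRing R] {n : ℕ} {Q : ℕ → R} {c : ℕ → ℕ → R}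
    (hdiag : ∀ k, k ≤ n + 1 → c k k = 1)
    (hrec : ∀ l m : ℕ, l + 1 < m → m ≤ n + 1 →
      c (l + 1) l * c m (l + 1) = c m l + Q (l + 1) * c m (l + 2))
    {k m : ℕ} (hkm : k < m) (hm : m ≤ n + 1) (d l : ℕ) (hk : k = l + 1 + d) :
    c k l * c m k = c m l + Q k * c m (k + 1) * c (k - 1) l := by
  induction d using Nat.twoStepInduction generalizing l with
  | zero =>
    subst hk
    simpa [hdiag l (by omega)] using hrec l m hkm hm
  | one =>
    subst hk
    have h₁ := hrec l (l + 2) (by omega) (by omega)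
    have h₂ := hrec l m (by omega) hm
    have h₃ := hrec (l + 1) m hkm hm
    rw [hdiag (l + 2) (by omega)] at h₁
    change c (l + 2) l * c m (l + 2) = c m l + Q (l + 2) * c m (l + 3) * c (l + 1) l
    linear_combination -c m (l + 2) * h₁ + h₂ + c (l + 1) l * h₃
  | more d ih₀ ih₁ =>
    have h₁ := hrec l k (by omega) (by omega)
    have h₂ := hrec l m (by omega) hm
    have h₃ := hrec l (k - 1) (by omega) (by omega)
    have h₄ := ih₁ (l + 1) (by omega)
    have h₅ := ih₀ (l + 2) (by omega)
    linear_combination -c m k * h₁ + h₂ + Q k * c m (k + 1) * h₃ + c (l + 1) l * h₄ -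
      Q (l + 1) * h₅


/-- Axiomatized exchange relation: for `0 ≤ l < k < m ≤ n+1`,
`c(k,l)·c(m,k) = c(m,l) + Q_k·c(m,k+1)·c(k−1,l)`
(in the paper `c_t^S(S_k/S_l) * c_t^S(S_m/S_k)
 = c_t^S(S_m/S_l) + (−1)^{N_k+N_{k−1}} q_k · c_t^S(S_m/S_{k+1}) * c_t^S(S_{k−1}/S_l)`,
 the index `l` being allowed to be zero). -/
theorem quantum_cluster_exchange_split {R : Type*} [CommRing R] (n : ℕ) (hn : 1 ≤ n)
    (Q : ℕ → R) (c : ℕ → ℕ → R)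
    (hdiag : ∀ k, k ≤ n + 1 → c k k = 1)
    (hE : ∀ k m : ℕ, 1 ≤ k → k < m → m ≤ n + 1 →
      c k 0 * c m k = c m 0 + Q k * c m (k + 1) * c (k - 1) 0)
    (hR : ∀ l, l ≤ n + 1 → c l 0 ∈ nonZeroDivisors R) :
    ∀ l k m : ℕ, l < k → k < m → m ≤ n + 1 →
      c k l * c m k = c m l + Q k * c m (k + 1) * c (k - 1) l := by
  intro l k m hlk hkm hm
  exact exchange_of_continuant hdiag (fun _ _ => exchange_of_succ hdiag hE hR) hkm hm
    (k - (l + 1)) l (by omega)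
end

section
/- (No matrix supported on two far-apart Plücker coordinates.) Let F be a field, r ≥ 2 and N ≥ r integers, and A an r × N matrix over F. For an r-element subset K ⊆ {1,…,N}, let A_K denote the r × r submatrix of A on the columns indexed by K. Suppose I and J are r-element subsets of {1,…,N} with |I ∩ J| ≤ r − 2 such that det A_I ≠ 0 and det A_J ≠ 0. Then there exists an r-element subset K ⊆ {1,…,N} with K ≠ I, K ≠ J and det A_K ≠ 0. -/
open Finset

/-- The maximal minor of an `r × N` matrix `A` on the `r`-element column set `K`
(columns taken in increasing order). -/
noncomputable def maximalMinor {F : Type*} [Field F] {r N : ℕ}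
    (A : Matrix (Fin r) (Fin N) F) (K : Finset (Fin N)) (h : K.card = r) : F :=
  (A.submatrix id (fun c : Fin r => ((K.orderIsoOfFin h) c : Fin N))).det

theorem maximalMinor_ne_zero_iff {F : Type*} [Field F] {r N : ℕ}
    (A : Matrix (Fin r) (Fin N) F) (K : Finset (Fin N)) (h : K.card = r) :
    maximalMinor A K h ≠ 0 ↔ LinearIndepOn F A.col (K : Set (Fin N)) := by
  rw [maximalMinor, ← isUnit_iff_ne_zero, ← Matrix.isUnit_iff_isUnit_det,
    ← Matrix.linearIndependent_cols_iff_isUnit]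
  exact linearIndependent_equiv (K.orderIsoOfFin h).toEquiv
    (f := fun k : K => A.col (k : Fin N))

/-- Steinitz exchange: a linearly independent family indexed by a finset can be extended by a member
of any larger one. -/
theorem LinearIndepOn.exists_insert_of_card_lt {ι F V : Type*} [DecidableEq ι] [Field F]
    [AddCommGroup V] [Module F V] {v : ι → V} {s t : Finset ι}
    (hs : LinearIndepOn F v (s : Set ι)) (ht : LinearIndepOn F v (t : Set ι))
    (hst : s.card < t.card) :
    ∃ y ∈ t, y ∉ s ∧ LinearIndepOn F v (insert y s : Finset ι) := by
  classical
  by_contra! hcon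
  have hspan : v '' t ⊆ Submodule.span F (s.image v : Set V) := by
    rintro _ ⟨y, hy, rfl⟩
    rw [coe_image]
    by_cases hys : y ∈ s
    · exact Submodule.subset_span ⟨y, hys, rfl⟩
    · by_contra hy'
      exact hcon y hy hys (by simpa using hs.insert hy')
  have hcard : t.card ≤ s.card := calc
    t.card = Module.finrank F (Submodule.span F (Set.range fun i : t => v i)) := by
      exact (Fintype.card_coe t).symm.trans (finrank_span_eq_card ht).symm
    _ ≤ Module.finrank F (Submodule.span F (s.image v : Set V)) := by
      refine Submodule.finrank_mono (Submodule.span_le.2 ?_)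
      rintro _ ⟨i, rfl⟩
      exact hspan ⟨i, i.2, rfl⟩
    _ ≤ (s.image v).card := finrank_span_finset_le_card _
    _ ≤ s.card := card_image_le
  omega

/-- No matrix supported on two far-apart Plücker coordinates: if `r ≥ 2`,
`N ≥ r`, and `I, J` are `r`-element column sets with `|I ∩ J| ≤ r − 2` on which
the maximal minors of `A` are nonzero, then some third `r`-element column set
`K ≠ I, J` also has nonzero maximal minor. -/
theorem no_two_far_plucker {F : Type*} [Field F] (r N : ℕ) (hr : 2 ≤ r) (hN : r ≤ N)
    (A : Matrix (Fin r) (Fin N) F) (I J : Finset (Fin N))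
    (hI : I.card = r) (hJ : J.card = r) (hIJ : (I ∩ J).card ≤ r - 2)
    (hdI : maximalMinor A I hI ≠ 0) (hdJ : maximalMinor A J hJ ≠ 0) :
    ∃ (K : Finset (Fin N)) (hK : K.card = r),
      K ≠ I ∧ K ≠ J ∧ maximalMinor A K hK ≠ 0 := by
  rw [maximalMinor_ne_zero_iff] at hdI hdJ
  obtain ⟨x, hxI, hxJ⟩ : ∃ x ∈ I, x ∉ J := by
    by_contra! h
    rw [inter_eq_left.2 h] at hIJ
    omega
  have hcard : (I.erase x).card = r - 1 := by rw [card_erase_of_mem hxI, hI]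
  obtain ⟨y, hyJ, hyI, hy⟩ := LinearIndepOn.exists_insert_of_card_lt
    (hdI.mono (coe_subset.2 (erase_subset x I))) hdJ (by omega)
  have hK : (insert y (I.erase x)).card = r := by
    rw [card_insert_of_notMem hyI]
    omega
  refine ⟨insert y (I.erase x), hK, fun h => ?_, fun h => ?_,
    (maximalMinor_ne_zero_iff A _ hK).2 hy⟩
  · have hx : x ∈ insert y (I.erase x) := by rwa [h]
    simp only [mem_insert, mem_erase, ne_eq, not_true_eq_false, false_and, or_false] at hx
    exact hxJ (hx ▸ hyJ)
  · have hsub : I.erase x ⊆ I ∩ J :=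
      subset_inter (erase_subset x I) (h ▸ subset_insert y (I.erase x))
    have := card_le_card hsub
    omega
end
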